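/- For every rational number x, E(f(C(x))) = x. -/

import Mathlib

/-- Continued fraction value of a list of integers (junk value `0` on `[]`,
division by zero yields junk, as usual in Lean). -/
def E : List ℤ → ℚ
  | [] => 0
  | [q] => (q : ℚ)
  | q :: l => (q : ℚ) + 1 / E l

/-- The continued fraction value of the list is well defined: the list is
nonempty and no division by zero occurs in the evaluation of `E`. -/
def EWellDef : List ℤ → Prop
  | [] => False
  | [_] => True
  | _ :: l => EWellDef l ∧ E l ≠ 0

/-- Membership in `A₀`: `[q₀,…,q_r]` with `q_i ≠ 0` for `1 ≤ i ≤ r` and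
`E([q_i,…,q_r]) ≠ 0` for `0 < i < r`. -/
def memA0 (l : List ℤ) : Prop :=
  l ≠ [] ∧ (∀ i, 0 < i → i < l.length → l.getD i 0 ≠ 0) ∧
    ∀ i, 0 < i → i + 1 < l.length → E (l.drop i) ≠ 0

/-- Membership in `A₁`: member of `A₀` with `q_i ≥ 1` for `0 < i < r` and
`q_r > 1` when `r > 0`. -/
def memA1 (l : List ℤ) : Prop :=
  memA0 l ∧ (∀ i, 0 < i → i + 1 < l.length → 1 ≤ l.getD i 0) ∧
    (1 < l.length → 1 < l.getD (l.length - 1) 0)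

/-- Membership in `A₂`: member of `A₀` with `|q_i| > 1` for `0 < i ≤ r`. -/
def memA2 (l : List ℤ) : Prop :=
  memA0 l ∧ ∀ i, 0 < i → i < l.length → 1 < |l.getD i 0|

/-- Euclidean-algorithm computation of the short continued fraction of `a/b`. -/
def scfAux (a : ℤ) (b : ℕ) : List ℤ :=
  if hb : b = 0 then []
  else
    have h0 : 0 ≤ Int.emod a (b : ℤ) := Int.emod_nonneg a (by exact_mod_cast hb)
    have h1 : Int.emod a (b : ℤ) < (b : ℤ) :=
      Int.emod_lt_of_pos a (by exact_mod_cast Nat.pos_of_ne_zero hb)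
    if hr : (Int.emod a (b : ℤ)).toNat = 0 then [Int.ediv a (b : ℤ)]
    else Int.ediv a (b : ℤ) :: scfAux (b : ℤ) (Int.emod a (b : ℤ)).toNat
  termination_by b
  decreasing_by omega

/-- `C x` is the short continued fraction representation of the rational `x`,
i.e. the unique list in `A₁` whose continued fraction value is `x`. -/
def C (x : ℚ) : List ℤ := scfAux x.num x.den

/-- Entrywise negation of a list. -/
def negL (l : List ℤ) : List ℤ := l.map (fun q => -q)

/-- The operation `⊕` on lists. -/
def oplus (a b : List ℤ) : List ℤ :=
  match b with
  | [] => a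
  | p :: ps =>
    if p = 0 then a.dropLast ++ (a.getLastD 0 + ps.headD 0) :: ps.tail
    else a ++ (p :: ps)

/-- The function `f : A₁ → A₂`. -/
def f (l : List ℤ) : List ℤ :=
  if h : (l.tail.dropLast).findIdx (fun q => q == 1) < l.tail.dropLast.length then
    let j := (l.tail.dropLast).findIdx (fun q => q == 1) + 1
    oplus (l.take (j - 1) ++ [l.getD (j - 1) 0 + 1])
      (negL (f ((l.getD (j + 1) 0 + 1) :: l.drop (j + 2))))
  else l
  termination_by l.length
  decreasing_by
    simp only [List.length_dropLast, List.length_tail, List.length_cons,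
      List.length_drop] at h ⊢
    omega

/-- The function `g : A₂ → A₁`. -/
def g (l : List ℤ) : List ℤ :=
  if h : (l.tail).findIdx (fun q => decide (q < 0)) < l.tail.length then
    let j := (l.tail).findIdx (fun q => decide (q < 0)) + 1
    oplus (l.take (j - 1) ++ [l.getD (j - 1) 0 - 1, 1])
      (g (negL ((l.getD j 0 + 1) :: l.drop (j + 1))))
  else l
  termination_by l.length
  decreasing_by
    simp only [negL, List.length_map, List.length_cons, List.length_drop,
      List.length_tail] at h ⊢
    omega

/-- `[q₀,…,q_r]` satisfies the `(u,v)`-divisibility property: `v ∣ q_i` for even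
`i` and `u ∣ q_i` for odd `i`. -/
def DivProp (u v : ℤ) (l : List ℤ) : Prop :=
  ∀ i, i < l.length → (i % 2 = 0 → v ∣ l.getD i 0) ∧ (i % 2 = 1 → u ∣ l.getD i 0)

theorem E_cons (q : ℤ) (l : List ℤ) : E (q :: l) = q + 1 / E l := by
  cases l <;> simp [E]

theorem E_negL (l : List ℤ) : E (negL l) = -E l := by
  induction l with
  | nil => simp [negL, E]
  | cons q l ih =>
    have h : negL (q :: l) = -q :: negL l := rfl
    rw [h, E_cons, E_cons, ih]
    push_cast
    rw [one_div, one_div, inv_neg]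
    ring

theorem E_nonneg {l : List ℤ} (hl : ∀ q ∈ l, 1 ≤ q) : 0 ≤ E l := by
  induction l with
  | nil => simp [E]
  | cons q l ih =>
    rw [List.forall_mem_cons] at hl
    have hq : (1 : ℚ) ≤ q := by exact_mod_cast hl.1
    have := one_div_nonneg.2 (ih hl.2)
    rw [E_cons]
    linarith

theorem f_singleton (a : ℤ) : f [a] = [a] := by
  rw [f]; simp

theorem f_pair (a b : ℤ) : f [a, b] = [a, b] := by
  rw [f]; simp

theorem f_cons_one (a c : ℤ) (t : List ℤ) :
    f (a :: 1 :: c :: t) = oplus [a + 1] (negL (f ((c + 1) :: t))) := by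
  rw [f]; simp [List.findIdx_cons]

theorem oplus_cons (a : ℤ) {l : List ℤ} (hl : l ≠ []) (m : List ℤ) :
    oplus (a :: l) m = a :: oplus l m := by
  obtain ⟨b, l, rfl⟩ := List.exists_cons_of_ne_nil hl
  cases m with
  | nil => rfl
  | cons p ps =>
    simp only [oplus]
    split_ifs <;> simp [List.getLastD]

theorem f_cons_of_ne_one (a c : ℤ) {b : ℤ} (hb : b ≠ 1) (t : List ℤ) :
    f (a :: b :: c :: t) = a :: f (b :: c :: t) := by
  have hidx : (a :: b :: c :: t).tail.dropLast.findIdx (fun q => q == 1) =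
      (b :: c :: t).tail.dropLast.findIdx (fun q => q == 1) + 1 := by
    simp [List.findIdx_cons, beq_eq_false_iff_ne.2 hb]
  have hlen : (a :: b :: c :: t).tail.dropLast.length =
      (b :: c :: t).tail.dropLast.length + 1 := by simp
  by_cases h : (b :: c :: t).tail.dropLast.findIdx (fun q => q == 1) <
      (b :: c :: t).tail.dropLast.length
  · rw [f, dif_pos (by omega), f.eq_1 (b :: c :: t), dif_pos h, hidx]
    simp only [Nat.add_sub_cancel, List.take_succ_cons, List.getD_cons_succ, List.cons_append,
      List.drop_succ_cons]
    rw [oplus_cons a (by simp)]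
  · rw [f, dif_neg (by omega), f.eq_1 (b :: c :: t), dif_neg h]

/-- On lists with positive partial quotients, `f` preserves the value and does not decrease the
leading entry. -/
theorem f_spec (a : ℤ) (t : List ℤ) (ht : ∀ q ∈ t, 1 ≤ q) :
    ∃ b s, f (a :: t) = b :: s ∧ a ≤ b ∧ E (b :: s) = E (a :: t) := by
  match t with
  | [] => exact ⟨a, [], f_singleton a, le_rfl, rfl⟩
  | [b] => exact ⟨a, [b], f_pair a b, le_rfl, rfl⟩
  | b :: c :: t =>
    simp only [List.forall_mem_cons] at ht
    obtain ⟨hb, hc, ht⟩ := ht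
    by_cases h : b = 1
    · subst h
      obtain ⟨p, s, hf, hp, hE⟩ := f_spec (c + 1) t ht
      have hneg : negL (p :: s) = -p :: negL s := rfl
      refine ⟨a + 1, negL (p :: s), ?_, by omega, ?_⟩
      · rw [f_cons_one, hf, hneg, oplus, if_neg (by omega)]
        rfl
      · have hc' : (1 : ℚ) ≤ c := by exact_mod_cast hc
        have hpos : 0 < E (c :: t) := by
          rw [E_cons]
          have := one_div_nonneg.2 (E_nonneg ht)
          linarith
        have hsucc : E ((c + 1) :: t) = E (c :: t) + 1 := by
          rw [E_cons, E_cons]; push_cast; ring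
        rw [E_cons, E_negL, hE, hsucc, E_cons a, E_cons 1]
        generalize E (c :: t) = y at hpos
        push_cast
        have h₁ : y ≠ 0 := hpos.ne'
        have h₂ : y + 1 ≠ 0 := by positivity
        have h₃ : 1 + 1 / y = (y + 1) / y := by field_simp
        rw [h₃, one_div_div, one_div, inv_neg]
        field_simp
        ring
    · obtain ⟨p, s, hf, -, hE⟩ := f_spec b (c :: t) (List.forall_mem_cons.2 ⟨hc, ht⟩)
      refine ⟨a, p :: s, by rw [f_cons_of_ne_one a c h, hf], le_rfl, ?_⟩
      rw [E_cons, hE, ← E_cons]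
  termination_by t.length

/-- The Euclidean algorithm yields positive partial quotients and the value `a / b`. -/
theorem scfAux_spec (a : ℤ) (b : ℕ) (hb : 0 < b) :
    ∃ t, scfAux a b = a / (b : ℤ) :: t ∧ (∀ q ∈ t, 1 ≤ q) ∧
      E (scfAux a b) = (a : ℚ) / b := by
  induction b using Nat.strong_induction_on generalizing a with
  | _ b ih =>
    have hbZ : (0 : ℤ) < b := by exact_mod_cast hb
    have hbQ : (b : ℚ) ≠ 0 := by exact_mod_cast hb.ne'
    have h0 : 0 ≤ a % (b : ℤ) := Int.emod_nonneg a hbZ.ne'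
    have h1 : a % (b : ℤ) < b := Int.emod_lt_of_pos a hbZ
    have hdiv : (b : ℤ) * (a / b) + a % b = a := Int.mul_ediv_add_emod a b
    obtain ⟨r, hr⟩ := Int.eq_ofNat_of_zero_le h0
    have hunfold : scfAux a b =
        if r = 0 then [a / (b : ℤ)] else a / (b : ℤ) :: scfAux b r := by
      rw [scfAux, dif_neg hb.ne']
      change (if _ : (a % (b : ℤ)).toNat = 0 then [a / (b : ℤ)]
        else a / (b : ℤ) :: scfAux b (a % (b : ℤ)).toNat) = _
      rw [hr, Int.toNat_natCast, dite_eq_ite]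
    rw [hr] at hdiv h1
    have hdivQ : (b : ℚ) * ((a / (b : ℤ) : ℤ) : ℚ) + r = a := by exact_mod_cast hdiv
    rw [hunfold]
    split_ifs with hr0
    · refine ⟨[], rfl, by simp, ?_⟩
      rw [E, eq_div_iff hbQ, ← hdivQ, hr0]
      push_cast
      ring
    · obtain ⟨t, ht, hpos, hE⟩ := ih r (by exact_mod_cast h1) b (Nat.pos_of_ne_zero hr0)
      have hrZ : (0 : ℤ) < r := by exact_mod_cast Nat.pos_of_ne_zero hr0
      have hhead : 1 ≤ (b : ℤ) / r := (Int.le_ediv_iff_mul_le hrZ).2 (by omega)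
      refine ⟨_, rfl, ht ▸ List.forall_mem_cons.2 ⟨hhead, hpos⟩, ?_⟩
      rw [E_cons, hE, Int.cast_natCast, one_div_div, eq_div_iff hbQ, add_mul,
        div_mul_cancel₀ _ hbQ, mul_comm, hdivQ]

/-- for every rational number `x`, `E(f(C(x))) = x`. -/
theorem E_f_C (x : ℚ) : E (f (C x)) = x := by
  obtain ⟨t, ht, hpos, hE⟩ := scfAux_spec x.num x.den x.pos
  obtain ⟨b, s, hf, -, hEf⟩ := f_spec (x.num / (x.den : ℤ)) t hpos
  rw [C, ht, hf, hEf, ← ht, hE, Rat.num_div_den]
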